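/- Let n ≥ 2, α > 1, μ ≥ 0 and 0 < δ₀ < 1/(n(n−1)). Let Γ̂ be the set of symmetric n×n real matrices A with tr(A) > 0 and ‖A − (tr(A)/n)I‖² < δ₀·tr(A)², where ‖·‖ is the Frobenius norm. Let F be a real-valued function which is twice continuously differentiable on an open subset of the n×n real matrices containing Γ̂ ∪ {tI : t > 0}, satisfying: (i) F(Oᵀ A O) = F(A) for all orthogonal O whenever both arguments lie in the domain; (ii) F(tA) = t^α F(A) for t > 0 whenever both arguments lie in the domain; (iii) F(I) = n^α; (iv) for every A ∈ Γ̂ and every symmetric B, the second Fréchet derivative satisfies |D²F(A)[B,B]| ≤ μ·tr(A)^{α−2}·‖B‖². Then for every A ∈ Γ̂ and every symmetric n×n matrix B, with H := tr(A) and Å := A − (H/n)I, one has |DF(A)[B] − α·H^{α−1}·tr(B)| ≤ μ·H^{α−2}·‖Å‖·‖B‖. -/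

import Mathlib

attribute [local instance] Matrix.frobeniusNormedAddCommGroup Matrix.frobeniusNormedSpace

open Matrix

/-- Parallelogram law for the Frobenius norm. -/
lemma Matrix.frobenius_parallelogram {m n : Type*} [Fintype m] [Fintype n]
    (X Y : Matrix m n ℝ) :
    ‖X + Y‖ ^ 2 + ‖X - Y‖ ^ 2 = 2 * (‖X‖ ^ 2 + ‖Y‖ ^ 2) := by
  have key (Z : Matrix m n ℝ) : ‖Z‖ ^ 2 = ∑ i, ∑ j, Z i j ^ 2 := by
    rw [frobenius_norm_def, ← Real.sqrt_eq_rpow, Real.sq_sqrt (by positivity)]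
    simp
  simp only [key, ← Finset.sum_add_distrib, Finset.mul_sum]
  refine Finset.sum_congr rfl fun i _ => Finset.sum_congr rfl fun j _ => ?_
  simp only [Matrix.add_apply, Matrix.sub_apply]
  ring

/-- A symmetric bilinear form is bounded by the same constant as its quadratic form, on any
subspace of a normed space that satisfies the parallelogram law. -/
lemma abs_bilin_le_of_abs_quadratic_le {E : Type*} [NormedAddCommGroup E] [NormedSpace ℝ E]
    (hpar : ∀ x y : E, ‖x + y‖ ^ 2 + ‖x - y‖ ^ 2 = 2 * (‖x‖ ^ 2 + ‖y‖ ^ 2))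
    (S : Submodule ℝ E) (Q : E →L[ℝ] E →L[ℝ] ℝ) (hsymm : ∀ x y, Q x y = Q y x) {C : ℝ}
    (hQ : ∀ x ∈ S, |Q x x| ≤ C * ‖x‖ ^ 2) {x y : E} (hx : x ∈ S) (hy : y ∈ S) :
    |Q x y| ≤ C * ‖x‖ * ‖y‖ := by
  rcases eq_or_ne x 0 with rfl | hx0
  · simp
  rcases eq_or_ne y 0 with rfl | hy0
  · simp
  have polar (u v : E) (hu : u ∈ S) (hv : v ∈ S) :
      2 * |Q u v| ≤ C * (‖u‖ ^ 2 + ‖v‖ ^ 2) := by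
    have h1 := hQ _ (S.add_mem hu hv)
    have h2 := hQ _ (S.sub_mem hu hv)
    have h3 : Q (u + v) (u + v) - Q (u - v) (u - v) = 4 * Q u v := by
      simp only [map_add, map_sub, _root_.add_apply, _root_.sub_apply,
        hsymm v u]
      ring
    have h4 := abs_sub (Q (u + v) (u + v)) (Q (u - v) (u - v))
    rw [h3, abs_mul, abs_of_pos (by norm_num : (0 : ℝ) < 4)] at h4
    linear_combination (h4 + h1 + h2 + C * hpar u v) / 2
  have hxp := norm_pos_iff.2 hx0
  have hyp := norm_pos_iff.2 hy0
  have h := polar (‖y‖ • x) (‖x‖ • y) (S.smul_mem _ hx) (S.smul_mem _ hy)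
  simp only [map_smul, _root_.smul_apply, smul_eq_mul, abs_mul, norm_smul,
    abs_norm, norm_norm] at h
  refine le_of_mul_le_mul_left ?_ (mul_pos (mul_pos two_pos hxp) hyp)
  linear_combination h

/-- Mean value estimate for the derivative along a segment, when the second derivative is bounded
only as a quadratic form on a subspace `S` containing the directions involved. -/
lemma abs_fderiv_sub_fderiv_le_of_abs_second_fderiv_le {E : Type*} [NormedAddCommGroup E]
    [NormedSpace ℝ E]
    (hpar : ∀ x y : E, ‖x + y‖ ^ 2 + ‖x - y‖ ^ 2 = 2 * (‖x‖ ^ 2 + ‖y‖ ^ 2))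
    (S : Submodule ℝ E) {F : E → ℝ} {V : Set E} (hV : IsOpen V) (hF : ContDiffOn ℝ 2 F V)
    {x v : E} {C : ℝ} (hseg : ∀ s ∈ Set.Icc (0 : ℝ) 1, x + s • v ∈ V)
    (hD2 : ∀ s ∈ Set.Icc (0 : ℝ) 1, ∀ y ∈ S,
      |fderiv ℝ (fun z => fderiv ℝ F z y) (x + s • v) y| ≤ C * ‖y‖ ^ 2)
    (hv : v ∈ S) {B : E} (hB : B ∈ S) :
    |fderiv ℝ F (x + v) B - fderiv ℝ F x B| ≤ C * ‖v‖ * ‖B‖ := by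
  have hcd (s : ℝ) (hs : s ∈ Set.Icc (0 : ℝ) 1) : ContDiffAt ℝ 2 F (x + s • v) :=
    hF.contDiffAt (hV.mem_nhds (hseg s hs))
  have hdiff (s : ℝ) (hs : s ∈ Set.Icc (0 : ℝ) 1) :
      DifferentiableAt ℝ (fderiv ℝ F) (x + s • v) :=
    ((hcd s hs).fderiv_right (m := 1) (by norm_num)).differentiableAt (by norm_num)
  have hmv := norm_image_sub_le_of_norm_deriv_le_segment_01'
    (f := fun s : ℝ => fderiv ℝ F (x + s • v) B)
    (f' := fun s => fderiv ℝ (fderiv ℝ F) (x + s • v) v B) (C := C * ‖v‖ * ‖B‖)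
    (fun s hs => by
      have hline : HasDerivAt (fun s : ℝ => x + s • v) v s := by
        simpa using ((hasDerivAt_id s).smul_const v).const_add x
      have hcomp := (hdiff s hs).hasFDerivAt.comp_hasDerivAt s hline
      simpa using (hcomp.clm_apply (hasDerivAt_const s B)).hasDerivWithinAt)
    (fun s hs => by
      replace hs := Set.Ico_subset_Icc_self hs
      refine abs_bilin_le_of_abs_quadratic_le hpar S _
        (fun y z => ((hcd s hs).isSymmSndFDerivAt (by simp)) y z) (fun y hy => ?_) hv hB
      have h := hD2 s hs y hy
      rw [fderiv_clm_apply (hdiff s hs) (differentiableAt_const y)] at h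
      simpa using h)
  simpa using hmv

/-- The derivative at a fixed point of a linear symmetry `T` of `F` is invariant under `T`. -/
lemma fderiv_apply_eq_of_comp_eventuallyEq {E : Type*} [NormedAddCommGroup E] [NormedSpace ℝ E]
    {F : E → ℝ} {x : E} (hF : DifferentiableAt ℝ F x) (T : E →L[ℝ] E) (hT : T x = x)
    (hFT : F ∘ T =ᶠ[nhds x] F) (B : E) : fderiv ℝ F x (T B) = fderiv ℝ F x B := by
  have h1 : HasFDerivAt (F ∘ T) ((fderiv ℝ F x).comp T) x := by
    refine HasFDerivAt.comp x ?_ T.hasFDerivAt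
    rw [hT]
    exact hF.hasFDerivAt
  have h2 := (h1.congr_of_eventuallyEq hFT.symm).fderiv
  simpa using (DFunLike.congr_fun h2 B).symm

/-- Euler's relation at a single point. -/
lemma fderiv_apply_self_of_homogeneous {E : Type*} [NormedAddCommGroup E] [NormedSpace ℝ E]
    {F : E → ℝ} {x : E} {α : ℝ} (hF : DifferentiableAt ℝ F x)
    (hom : ∀ t : ℝ, 0 < t → F (t • x) = t ^ α * F x) : fderiv ℝ F x x = α * F x := by
  have h1 : HasDerivAt (fun t : ℝ => F (t • x)) (fderiv ℝ F x x) 1 := by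
    have h : HasDerivAt (fun t : ℝ => t • x) x 1 := by
      simpa using (hasDerivAt_id (1 : ℝ)).smul_const x
    refine HasFDerivAt.comp_hasDerivAt (1 : ℝ) ?_ h
    rw [one_smul]
    exact hF.hasFDerivAt
  have h2 : HasDerivAt (fun t : ℝ => t ^ α * F x) (α * F x) 1 := by
    simpa using (Real.hasDerivAt_rpow_const (p := α) (Or.inl one_ne_zero)).mul_const (F x)
  refine h1.unique (h2.congr_of_eventuallyEq ?_)
  filter_upwards [lt_mem_nhds (zero_lt_one (α := ℝ))] with t ht using hom t ht

/-- An orthogonally invariant linear functional on symmetric matrices is a multiple of the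
trace. -/
lemma Matrix.card_mul_apply_eq_trace_mul_of_orthogonal_invariant {n : Type*} [Fintype n]
    [DecidableEq n] (L : Matrix n n ℝ →ₗ[ℝ] ℝ)
    (hL : ∀ O : Matrix n n ℝ, Oᵀ * O = 1 → ∀ B, L (Oᵀ * B * O) = L B)
    {B : Matrix n n ℝ} (hB : Bᵀ = B) :
    Fintype.card n * L B = B.trace * L 1 := by
  have hswap (i j : n) : L (Matrix.single i i 1) = L (Matrix.single j j 1) := by
    have hP : ((Equiv.swap i j).permMatrix ℝ)ᵀ * (Equiv.swap i j).permMatrix ℝ = 1 := by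
      rw [Matrix.transpose_permMatrix, ← Matrix.permMatrix_mul]
      simp
    rw [← hL _ hP (Matrix.single i i 1), Matrix.transpose_permMatrix, Equiv.swap_inv,
      Equiv.Perm.permMatrix, PEquiv.toMatrix_toPEquiv_mul, PEquiv.mul_toMatrix_toPEquiv]
    congr 1
    ext a b
    simp [Matrix.single_apply, ← Equiv.symm_apply_eq]
  have hdiag (d : n → ℝ) : Fintype.card n * L (diagonal d) = (∑ i, d i) * L 1 := by
    have hsum (d : n → ℝ) : L (diagonal d) = ∑ i, d i * L (Matrix.single i i 1) := by
      rw [← Matrix.sum_single_eq_diagonal, map_sum]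
      refine Finset.sum_congr rfl fun i _ => ?_
      rw [← smul_eq_mul, ← map_smul, Matrix.smul_single, smul_eq_mul, mul_one]
    have hcard (i : n) : L 1 = Fintype.card n * L (Matrix.single i i 1) := by
      rw [← Matrix.diagonal_one, hsum]
      simp [fun j => hswap j i]
    rw [hsum, Finset.mul_sum, Finset.sum_mul]
    refine Finset.sum_congr rfl fun i _ => ?_
    rw [hcard i]
    ring
  have hH : B.IsHermitian := by simpa [Matrix.IsHermitian] using hB
  set U : Matrix n n ℝ := (hH.eigenvectorUnitary : Matrix n n ℝ) with hU
  have hspec : B = U * diagonal hH.eigenvalues * Uᵀ := by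
    simpa [Unitary.conjStarAlgAut_apply, Matrix.star_eq_conjTranspose, Function.comp_def]
      using hH.spectral_theorem
  have hUU : Uᵀᵀ * Uᵀ = 1 := by
    simpa [Matrix.star_eq_conjTranspose] using Unitary.coe_mul_star_self hH.eigenvectorUnitary
  have hLB : L B = L (diagonal hH.eigenvalues) := by
    rw [← hL Uᵀ hUU (diagonal hH.eigenvalues), Matrix.transpose_transpose, ← hspec]
  rw [hLB, hdiag]
  congr 1
  simpa using hH.trace_eq_sum_eigenvalues.symm

/-- Estimate (4.2) of the paper: for an `O(n)`-invariant speed function `F`, homogeneous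
of degree `α`, normalized by `F(I) = n^α`, and with second derivatives bounded by `μ` on
the pinching cone `Γ̂`, the derivative at `A ∈ Γ̂` satisfies
`|DF(A)[B] - α H^{α-1} tr B| ≤ μ H^{α-2} ‖Å‖ ‖B‖`, where `H = tr A` and `Å = A - (H/n)I`. -/
theorem stmt_10 (n : ℕ) (hn : 2 ≤ n) (α μ δ₀ : ℝ) (hα : 1 < α) (hμ : 0 ≤ μ)
    (hδ₀ : 0 < δ₀) (hδ₀' : δ₀ < 1 / (n * (n - 1)))
    (Γhat : Set (Matrix (Fin n) (Fin n) ℝ))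
    (hΓhat : Γhat = {A : Matrix (Fin n) (Fin n) ℝ | Aᵀ = A ∧ 0 < A.trace ∧
      ‖A - (A.trace / n) • (1 : Matrix (Fin n) (Fin n) ℝ)‖ ^ 2 < δ₀ * A.trace ^ 2})
    (V : Set (Matrix (Fin n) (Fin n) ℝ)) (hV : IsOpen V)
    (hVΓ : Γhat ⊆ V) (hVray : ∀ t : ℝ, 0 < t → t • (1 : Matrix (Fin n) (Fin n) ℝ) ∈ V)
    (F : Matrix (Fin n) (Fin n) ℝ → ℝ)
    (hF : ContDiffOn ℝ 2 F V)
    (hinv : ∀ O : Matrix (Fin n) (Fin n) ℝ, Oᵀ * O = 1 →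
      ∀ A ∈ V, Oᵀ * A * O ∈ V → F (Oᵀ * A * O) = F A)
    (hhomog : ∀ t : ℝ, 0 < t → ∀ A ∈ V, t • A ∈ V → F (t • A) = t ^ α * F A)
    (hnorm : F 1 = (n : ℝ) ^ α)
    (hD2 : ∀ A ∈ Γhat, ∀ B : Matrix (Fin n) (Fin n) ℝ, Bᵀ = B →
      |fderiv ℝ (fun X => fderiv ℝ F X B) A B| ≤ μ * A.trace ^ (α - 2) * ‖B‖ ^ 2) :
    ∀ A ∈ Γhat, ∀ B : Matrix (Fin n) (Fin n) ℝ, Bᵀ = B →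
      |fderiv ℝ F A B - α * A.trace ^ (α - 1) * B.trace| ≤
        μ * A.trace ^ (α - 2) *
          ‖A - (A.trace / n) • (1 : Matrix (Fin n) (Fin n) ℝ)‖ * ‖B‖ := by
  intro A hA B hB
  have hA' := hA
  rw [hΓhat] at hA'
  obtain ⟨hAt, hApos, hAlt⟩ := hA'
  have hn0 : (0 : ℝ) < n := by
    have : 0 < n := by omega
    exact_mod_cast this
  set H := A.trace with hH
  set c := H / n with hc
  have hcpos : 0 < c := div_pos hApos hn0
  set A₀ : Matrix (Fin n) (Fin n) ℝ := A - c • (1 : Matrix (Fin n) (Fin n) ℝ) with hA₀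
  have hA₀t : A₀ᵀ = A₀ := by simp [hA₀, hAt]
  have hA₀tr : A₀.trace = 0 := by
    simp only [hA₀, trace_sub, trace_smul, trace_one, Fintype.card_fin, smul_eq_mul, ← hH, hc]
    field_simp
    ring
  have hdiff (X) (hX : X ∈ V) : DifferentiableAt ℝ F X :=
    (hF.contDiffAt (hV.mem_nhds hX)).differentiableAt (by norm_num)
  -- the derivative at the umbilic point with the same trace
  have hcenter : fderiv ℝ F (c • (1 : Matrix (Fin n) (Fin n) ℝ)) B
      = α * H ^ (α - 1) * B.trace := by
    have hcV := hVray c hcpos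
    have h1V : (1 : Matrix (Fin n) (Fin n) ℝ) ∈ V := by simpa using hVray 1 one_pos
    have hFc : F (c • (1 : Matrix (Fin n) (Fin n) ℝ)) = H ^ α := by
      rw [hhomog c hcpos 1 h1V hcV, hnorm, ← Real.mul_rpow hcpos.le hn0.le, hc,
        div_mul_cancel₀ _ hn0.ne']
    have heuler := fderiv_apply_self_of_homogeneous (α := α) (hdiff _ hcV) fun t ht =>
      hhomog t ht _ hcV (by rw [smul_smul]; exact hVray _ (mul_pos ht hcpos))
    have hL := Matrix.card_mul_apply_eq_trace_mul_of_orthogonal_invariant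
      (fderiv ℝ F (c • (1 : Matrix (Fin n) (Fin n) ℝ))).toLinearMap (fun O hO X => by
        let T : Matrix (Fin n) (Fin n) ℝ →L[ℝ] Matrix (Fin n) (Fin n) ℝ :=
          LinearMap.toContinuousLinearMap
            ((LinearMap.mulRight ℝ O).comp (LinearMap.mulLeft ℝ Oᵀ))
        have hTapp (Y) : T Y = Oᵀ * Y * O := rfl
        have hT : T (c • (1 : Matrix (Fin n) (Fin n) ℝ)) = c • 1 := by
          simp [hTapp, hO]
        refine fderiv_apply_eq_of_comp_eventuallyEq (hdiff _ hcV) T hT ?_ X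
        have hpre : T ⁻¹' V ∈ nhds (c • (1 : Matrix (Fin n) (Fin n) ℝ)) :=
          T.continuous.continuousAt.preimage_mem_nhds (by rw [hT]; exact hV.mem_nhds hcV)
        filter_upwards [hV.mem_nhds hcV, hpre] with Y hY hTY
        exact hinv O hO Y hY hTY) hB
    replace heuler : c * fderiv ℝ F (c • (1 : Matrix (Fin n) (Fin n) ℝ)) 1 = α * H ^ α := by
      rw [← hFc, ← heuler, ← smul_eq_mul]
      exact (map_smul _ _ _).symm
    replace hL : n * fderiv ℝ F (c • (1 : Matrix (Fin n) (Fin n) ℝ)) B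
        = B.trace * fderiv ℝ F (c • (1 : Matrix (Fin n) (Fin n) ℝ)) 1 := by
      rw [Fintype.card_fin] at hL
      exact hL
    have hpow : H ^ α = H ^ (α - 1) * H := by
      rw [← Real.rpow_add_one hApos.ne', sub_add_cancel]
    have hHc : H = n * c := by rw [hc]; field_simp
    refine mul_left_cancel₀ (mul_pos hcpos hn0).ne' ?_
    linear_combination c * hL + B.trace * heuler + B.trace * α * hpow
      + B.trace * α * H ^ (α - 1) * hHc
  -- the segment from the umbilic point to `A` stays in the cone
  have hpath (s : ℝ) (hs : s ∈ Set.Icc (0 : ℝ) 1) :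
      c • (1 : Matrix (Fin n) (Fin n) ℝ) + s • A₀ ∈ Γhat ∧
        (c • (1 : Matrix (Fin n) (Fin n) ℝ) + s • A₀).trace = H := by
    have htr : (c • (1 : Matrix (Fin n) (Fin n) ℝ) + s • A₀).trace = H := by
      simp only [trace_add, trace_smul, trace_one, Fintype.card_fin, smul_eq_mul, hA₀tr, hc]
      field_simp
      ring
    refine ⟨?_, htr⟩
    rw [hΓhat]
    refine ⟨by simp [hA₀t], by rw [htr]; exact hApos, ?_⟩
    rw [htr, ← hc, add_sub_cancel_left, norm_smul, mul_pow]
    refine lt_of_le_of_lt (mul_le_of_le_one_left (by positivity) ?_) hAlt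
    rw [Real.norm_eq_abs, sq_abs]
    exact pow_le_one₀ hs.1 hs.2
  let S : Submodule ℝ (Matrix (Fin n) (Fin n) ℝ) :=
    { carrier := {X | Xᵀ = X}
      add_mem' := fun {X Y} hX hY => by
        simp only [Set.mem_ofPred_eq] at hX hY ⊢
        rw [transpose_add, hX, hY]
      zero_mem' := transpose_zero
      smul_mem' := fun r X hX => by
        simp only [Set.mem_ofPred_eq] at hX ⊢
        rw [transpose_smul, hX] }
  have hmv := abs_fderiv_sub_fderiv_le_of_abs_second_fderiv_le
    Matrix.frobenius_parallelogram S hV hF (C := μ * H ^ (α - 2))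
    (fun s hs => hVΓ (hpath s hs).1)
    (fun s hs Y hY => by
      have h := hD2 _ (hpath s hs).1 Y hY
      rw [(hpath s hs).2] at h
      exact h) (v := A₀) hA₀t (B := B) hB
  have hA₀add : c • (1 : Matrix (Fin n) (Fin n) ℝ) + A₀ = A := add_sub_cancel _ _
  rw [hA₀add] at hmv
  rw [← hcenter]
  exact hmv
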